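/- Let s, a be complex numbers with Re s > 0 and Re a > 0, let c be a real number with max(−Re a, −1) < c < 0, and let z be a complex number with z ∉ [0,∞). Then (1/2π) ∫_{−∞}^{∞} Γ(1+c+it) Γ(−c−it) (−z)^{c+it} / (a+c+it)^s dt = (1/Γ(s)) ∫₀^∞ x^{s−1} e^{−a x}/(1 − z e^{−x}) dx; in particular the Mellin–Barnes integral provides the analytic continuation of the Lerch transcendent to the whole plane cut along [0,∞). -/

import Mathlib

open Complex MeasureTheory Set

open Filter Topology in
/-- Identity theorem on a convex open set, for two functions agreeing along a short segment. -/
lemma eqOn_of_eventually_eq_on_line {U : Set ℂ} (hU : IsOpen U) (hconv : Convex ℝ U) {f g : ℂ → ℂ}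
    (hf : DifferentiableOn ℂ f U) (hg : DifferentiableOn ℂ g U) {z₀ v : ℂ} (hz₀ : z₀ ∈ U)
    (hv : v ≠ 0) (h : ∀ᶠ r : ℝ in 𝓝 0, f (z₀ + r * v) = g (z₀ + r * v)) : EqOn f g U := by
  refine AnalyticOnNhd.eqOn_of_preconnected_of_frequently_eq (hf.analyticOnNhd hU)
    (hg.analyticOnNhd hU) hconv.isPreconnected hz₀ ?_
  have ht : Tendsto (fun r : ℝ ↦ z₀ + r * v) (𝓝[≠] 0) (𝓝[≠] z₀) := by
    refine tendsto_nhdsWithin_iff.2 ⟨?_, ?_⟩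
    · have : Continuous (fun r : ℝ ↦ z₀ + r * v) := by fun_prop
      simpa using (this.tendsto 0).mono_left nhdsWithin_le_nhds
    · filter_upwards [self_mem_nhdsWithin] with r hr
      simpa [hv] using hr
  exact ht.frequently (h.filter_mono nhdsWithin_le_nhds).frequently

lemma abs_mul_exp_le {δ r r₀ x : ℝ} (hδ : 0 < δ) (hr : |r - r₀| ≤ δ) :
    |x| * Real.exp (r * x) ≤
      δ⁻¹ * (Real.exp ((r₀ + 2 * δ) * x) + Real.exp ((r₀ - 2 * δ) * x)) := by
  have h1 : |x| ≤ δ⁻¹ * Real.exp (δ * |x|) := by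
    rw [inv_mul_eq_div, le_div_iff₀ hδ]
    have := Real.add_one_le_exp (δ * |x|)
    linarith
  have h2 : r * x ≤ r₀ * x + δ * |x| := by
    have h3 : (r - r₀) * x ≤ |r - r₀| * |x| := by
      rw [← abs_mul]; exact le_abs_self _
    nlinarith [mul_le_mul_of_nonneg_right hr (abs_nonneg x)]
  calc |x| * Real.exp (r * x)
      ≤ (δ⁻¹ * Real.exp (δ * |x|)) * Real.exp (r₀ * x + δ * |x|) := by gcongr
    _ = δ⁻¹ * Real.exp (r₀ * x + 2 * δ * |x|) := by
        rw [mul_assoc, ← Real.exp_add]; ring_nf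
    _ ≤ _ := by
        gcongr
        rcases abs_cases x with ⟨h, -⟩ | ⟨h, -⟩
        · rw [h, ← add_mul]; exact le_add_of_nonneg_right (Real.exp_pos _).le
        · rw [h, show r₀ * x + 2 * δ * -x = (r₀ - 2 * δ) * x by ring]
          exact le_add_of_nonneg_left (Real.exp_pos _).le

/-- A two-sided Laplace transform is holomorphic in its strip of absolute convergence. -/
lemma differentiableOn_integral_mul_cexp {μ : Measure ℝ} {φ : ℝ → ℂ} {S : Set ℝ} (hS : IsOpen S)
    (h : ∀ r ∈ S, Integrable (fun x : ℝ ↦ φ x * cexp (r * x)) μ) :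
    DifferentiableOn ℂ (fun z : ℂ ↦ ∫ x : ℝ, φ x * cexp (z * x) ∂μ) {z | z.re ∈ S} := by
  intro z₀ hz₀
  obtain ⟨ε, hε, hball⟩ := Metric.isOpen_iff.1 hS _ hz₀
  have hmem : ∀ r : ℝ, |r - z₀.re| < ε → r ∈ S := fun r hr ↦ hball (by simpa [Real.dist_eq] using hr)
  have hmeas : ∀ z : ℂ, AEStronglyMeasurable (fun x : ℝ ↦ φ x * cexp (z * x)) μ := by
    intro z
    have h0 := ((h _ hz₀).aestronglyMeasurable).mul
      (Continuous.aestronglyMeasurable (μ := μ)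
        (show Continuous fun x : ℝ ↦ cexp ((z - z₀.re) * x) by fun_prop))
    refine h0.congr (.of_forall fun x ↦ ?_)
    simp only [Pi.mul_apply]
    rw [mul_assoc, ← Complex.exp_add]
    ring_nf
  have hint : ∀ z : ℂ, z.re ∈ S → Integrable (fun x : ℝ ↦ φ x * cexp (z * x)) μ := by
    intro z hz
    refine (h _ hz).congr' (hmeas z) (.of_forall fun x ↦ ?_)
    simp [Complex.norm_exp]
  set δ := ε / 4 with hδdef
  have hδ : 0 < δ := by positivity
  have hp := (h (z₀.re + 2 * δ) (hmem _ (by rw [add_sub_cancel_left, abs_of_pos] <;> linarith))).norm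
  have hm := (h (z₀.re - 2 * δ) (hmem _ (by rw [abs_lt]; constructor <;> linarith))).norm
  have key := hasDerivAt_integral_of_dominated_loc_of_deriv_le (μ := μ) (x₀ := z₀)
    (F := fun (z : ℂ) (x : ℝ) ↦ φ x * cexp (z * x))
    (F' := fun (z : ℂ) (x : ℝ) ↦ φ x * cexp (z * x) * x)
    (bound := fun x ↦ δ⁻¹ * (‖φ x * cexp ((z₀.re + 2 * δ : ℝ) * x)‖ +
      ‖φ x * cexp ((z₀.re - 2 * δ : ℝ) * x)‖))
    (Metric.ball_mem_nhds z₀ hδ) (.of_forall hmeas) (hint z₀ hz₀)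
    ((hmeas z₀).mul (by fun_prop)) ?_ ((hp.add hm).const_mul _) ?_
  · exact key.2.differentiableAt.differentiableWithinAt
  · refine .of_forall fun x z hz ↦ ?_
    have hre : |z.re - z₀.re| ≤ δ := by
      rw [← sub_re]
      exact (abs_re_le_norm _).trans (by simpa [dist_eq_norm] using (Metric.mem_ball.1 hz).le)
    have := mul_le_mul_of_nonneg_left (abs_mul_exp_le (x := x) hδ hre) (norm_nonneg (φ x))
    simp only [norm_mul, Complex.norm_exp, re_mul_ofReal, ofReal_re, Complex.norm_real,
      Real.norm_eq_abs]
    linarith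
  · refine .of_forall fun x z _ ↦ ?_
    have h1 : HasDerivAt (fun z : ℂ ↦ z * x) (x : ℂ) z := by
      simpa using (hasDerivAt_id z).mul_const (x : ℂ)
    simpa [mul_assoc] using h1.cexp.const_mul (φ x)

lemma integrableOn_cpow_mul_cexp {s : ℂ} (hs : 0 < s.re) {b : ℂ} (hb : 0 < b.re) :
    IntegrableOn (fun x : ℝ ↦ (x : ℂ) ^ (s - 1) * cexp (-b * x)) (Ioi 0) := by
  have h := integrableOn_rpow_mul_exp_neg_mul_rpow (s := s.re - 1) (p := 1) (b := b.re)
    (by linarith) one_pos hb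
  refine Integrable.congr' h ?_ ?_
  · refine ContinuousOn.aestronglyMeasurable ?_ measurableSet_Ioi
    refine ContinuousOn.mul (fun x hx ↦ ContinuousAt.continuousWithinAt ?_) (by fun_prop)
    exact (continuousAt_ofReal_cpow_const _ _ (Or.inr (ne_of_gt hx)))
  · filter_upwards [ae_restrict_mem measurableSet_Ioi] with x hx
    have hx : 0 < x := hx
    rw [norm_mul, norm_mul, Complex.norm_cpow_eq_rpow_re_of_pos hx, Complex.norm_exp,
      Real.norm_of_nonneg (Real.rpow_nonneg hx.le _), Real.norm_of_nonneg (Real.exp_pos _).le]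
    simp

open Filter Topology in
/-- Euler's integral for the Gamma function, with a complex scale. -/
lemma integral_cpow_mul_cexp {s : ℂ} (hs : 0 < s.re) {b : ℂ} (hb : 0 < b.re) :
    ∫ x in Ioi (0 : ℝ), (x : ℂ) ^ (s - 1) * cexp (-b * x) = Complex.Gamma s / b ^ s := by
  have hL := differentiableOn_integral_mul_cexp (μ := volume.restrict (Ioi (0 : ℝ)))
    (φ := fun x ↦ (x : ℂ) ^ (s - 1)) (S := Iio 0) isOpen_Iio (fun r hr ↦ by
      simpa using! integrableOn_cpow_mul_cexp hs (b := -(r : ℂ)) (by simpa using hr))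
  have hR : DifferentiableOn ℂ (fun z : ℂ ↦ Complex.Gamma s * (-z) ^ (-s)) {z | z.re ∈ Iio 0} := by
    intro z hz
    have : -z ∈ slitPlane := Or.inl (by simpa using hz)
    refine DifferentiableAt.differentiableWithinAt ?_
    exact ((differentiableAt_id.neg).cpow_const this).const_mul _
  have := eqOn_of_eventually_eq_on_line (z₀ := -1) (v := 1)
    (isOpen_Iio.preimage continuous_re) ((convex_Iio 0).linear_preimage reLm) hL hR
    (by simp) one_ne_zero ?_ (x := -b) (by simpa using hb)
  · simpa [cpow_neg, div_eq_mul_inv] using this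
  · filter_upwards [Iio_mem_nhds (zero_lt_one (α := ℝ))] with r hr
    have hr' : 0 < 1 - r := by simpa using hr
    have := Complex.integral_cpow_mul_exp_neg_mul_Ioi hs hr'
    have harg : ((1 - r : ℝ) : ℂ).arg ≠ Real.pi := by
      rw [arg_ofReal_of_nonneg hr'.le]; exact Real.pi_pos.ne
    rw [one_div, inv_cpow _ _ harg] at this
    rw [show -((-1 : ℂ) + r * 1) = (1 - r : ℝ) by push_cast; ring, cpow_neg, mul_comm (Complex.Gamma s), ← this]
    refine integral_congr_ae (.of_forall fun x ↦ ?_)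
    simp only
    congr 2
    push_cast; ring

open Filter Topology Asymptotics in
lemma mellinConvergent_one_add_inv {p : ℂ} (h0 : 0 < p.re) (h1 : p.re < 1) :
    MellinConvergent (fun y : ℝ ↦ (1 + (y : ℂ))⁻¹) p := by
  have hnorm : ∀ y : ℝ, 0 < y → ‖(1 + (y : ℂ))⁻¹‖ = (1 + y)⁻¹ := fun y hy ↦ by
    rw [norm_inv, ← ofReal_one, ← ofReal_add, norm_real, Real.norm_of_nonneg (by linarith)]
  refine mellinConvergent_of_isBigO_rpow (a := 1) (b := 0) ?_ ?_ h1 ?_ h0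
  · refine ContinuousOn.locallyIntegrableOn (fun y hy ↦ ?_) measurableSet_Ioi
    have hy : (0 : ℝ) < y := hy
    refine ContinuousAt.continuousWithinAt (ContinuousAt.inv₀ (by fun_prop) ?_)
    norm_cast; linarith
  · refine IsBigO.of_bound 1 ?_
    filter_upwards [eventually_gt_atTop 0] with y hy
    rw [hnorm y hy, Real.rpow_neg_one, Real.norm_of_nonneg (inv_nonneg.2 hy.le), one_mul]
    exact inv_anti₀ hy (by linarith)
  · refine IsBigO.of_bound 1 ?_
    filter_upwards [self_mem_nhdsWithin] with y hy
    have hy : (0 : ℝ) < y := hy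
    rw [hnorm y hy]
    simpa using inv_le_one_of_one_le₀ (by linarith : 1 ≤ 1 + y)

/-- The Mellin transform of `y ↦ (1 + y)⁻¹`. -/
lemma mellin_one_add_inv {p : ℂ} (h0 : 0 < p.re) (h1 : p.re < 1) :
    mellin (fun y : ℝ ↦ (1 + (y : ℂ))⁻¹) p = Complex.Gamma p * Complex.Gamma (1 - p) := by
  set K : ℝ → ℝ → ℂ := fun y v ↦ (y : ℂ) ^ (p - 1) * cexp (-(1 + y) * v)
  have hpos : ∀ᵐ y ∂(volume.restrict (Ioi (0 : ℝ))), 0 < y := ae_restrict_mem measurableSet_Ioi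
  have hexp : ∀ y : ℝ, 0 < y → ∫ v in Ioi (0 : ℝ), cexp (-(1 + y) * v) = (1 + (y : ℂ))⁻¹ := by
    intro y hy
    rw [integral_exp_mul_complex_Ioi (by simp; linarith)]
    rw [ofReal_zero, mul_zero, Complex.exp_zero, neg_div_neg_eq, one_div]
  have hmeas : AEStronglyMeasurable (Function.uncurry K)
      ((volume.restrict (Ioi (0 : ℝ))).prod (volume.restrict (Ioi (0 : ℝ)))) := by
    refine Measurable.aestronglyMeasurable ?_
    simp only [K, Function.uncurry_def]
    fun_prop
  have hint : Integrable (Function.uncurry K)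
      ((volume.restrict (Ioi (0 : ℝ))).prod (volume.restrict (Ioi (0 : ℝ)))) := by
    rw [integrable_prod_iff hmeas]
    constructor
    · filter_upwards [hpos] with y hy
      simp only [Function.uncurry_apply_pair, K]
      exact (integrableOn_exp_mul_complex_Ioi (by simp; linarith) 0).const_mul _
    · refine (mellinConvergent_one_add_inv h0 h1).norm.congr ?_
      filter_upwards [hpos] with y hy
      simp only [Function.uncurry_apply_pair, K, norm_mul, norm_smul]
      rw [integral_const_mul]
      congr 1
      have h2 : ∀ v : ℝ, ‖cexp (-(1 + y) * v)‖ = Real.exp (-(1 + y) * v) := fun v ↦ by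
        rw [Complex.norm_exp]; simp
      simp_rw [h2]
      rw [integral_exp_mul_Ioi (by linarith), norm_inv, ← ofReal_one, ← ofReal_add, norm_real,
        Real.norm_of_nonneg (by linarith)]
      rw [mul_zero, Real.exp_zero, neg_div_neg_eq, one_div]
  calc mellin (fun y : ℝ ↦ (1 + (y : ℂ))⁻¹) p
      = ∫ y in Ioi (0 : ℝ), ∫ v in Ioi (0 : ℝ), K y v := by
        refine setIntegral_congr_fun measurableSet_Ioi fun y hy ↦ ?_
        simp only [K, smul_eq_mul]
        rw [integral_const_mul, hexp y hy]
    _ = ∫ v in Ioi (0 : ℝ), ∫ y in Ioi (0 : ℝ), K y v := integral_integral_swap hint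
    _ = ∫ v in Ioi (0 : ℝ), Complex.Gamma p * ((v : ℂ) ^ (1 - p - 1) * cexp (-1 * v)) := by
        refine setIntegral_congr_fun measurableSet_Ioi fun v hv ↦ ?_
        have hv : 0 < v := hv
        have h3 : ∀ y : ℝ, K y v = cexp (-1 * v) * ((y : ℂ) ^ (p - 1) * cexp (-(v : ℂ) * y)) := by
          intro y
          rw [mul_left_comm, ← Complex.exp_add]
          simp only [K]
          ring_nf
        simp_rw [h3]
        rw [integral_const_mul, integral_cpow_mul_cexp h0 (by simpa using hv),
          show 1 - p - 1 = -p by ring, cpow_neg]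
        ring
    _ = _ := by
        rw [integral_const_mul, integral_cpow_mul_cexp (by simpa using h1) (by simp)]
        simp

/-- Exponential decay of the Gamma product along vertical lines. -/
lemma norm_Gamma_mul_Gamma_one_sub_le (p : ℂ) (h0 : 0 < p.re) (h1 : p.re < 1) :
    ‖Complex.Gamma p * Complex.Gamma (1 - p)‖ ≤
      2 * Real.pi / Real.sin (Real.pi * p.re) * Real.exp (-(Real.pi * |p.im|)) := by
  have hs : 0 < Real.sin (Real.pi * p.re) :=
    Real.sin_pos_of_pos_of_lt_pi (by positivity) (by nlinarith [Real.pi_pos])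
  have hlow : Real.sin (Real.pi * p.re) * Real.cosh (Real.pi * p.im) ≤
      ‖Complex.sin (Real.pi * p)‖ := by
    have hre : (Complex.sin (Real.pi * p)).re =
        Real.sin (Real.pi * p.re) * Real.cosh (Real.pi * p.im) := by
      have : (Real.pi : ℂ) * p = (Real.pi * p.re : ℝ) + (Real.pi * p.im : ℝ) * I := by
        conv_lhs => rw [← re_add_im p]
        push_cast; ring
      rw [this, Complex.sin_add_mul_I, ← ofReal_sin, ← ofReal_cosh, ← ofReal_cos, ← ofReal_sinh]
      simp [-ofReal_mul, -ofReal_sin, -ofReal_cos, -ofReal_cosh, -ofReal_sinh]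
    rw [← hre]
    exact re_le_norm _
  have hcosh : Real.exp (Real.pi * |p.im|) / 2 ≤ Real.cosh (Real.pi * p.im) := by
    rw [← Real.cosh_abs, abs_mul, abs_of_pos Real.pi_pos, Real.cosh_eq]
    have := Real.exp_pos (-(Real.pi * |p.im|))
    linarith
  rw [Complex.Gamma_mul_Gamma_one_sub, norm_div, norm_real, Real.norm_of_nonneg Real.pi_pos.le]
  have hle : Real.sin (Real.pi * p.re) * (Real.exp (Real.pi * |p.im|) / 2) ≤
      ‖Complex.sin (Real.pi * p)‖ :=
    (mul_le_mul_of_nonneg_left hcosh hs.le).trans hlow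
  calc Real.pi / ‖Complex.sin (Real.pi * p)‖
      ≤ Real.pi / (Real.sin (Real.pi * p.re) * (Real.exp (Real.pi * |p.im|) / 2)) := by
        gcongr
    _ = _ := by rw [Real.exp_neg]; field_simp

lemma integrable_exp_neg_mul_abs {κ : ℝ} (hκ : 0 < κ) :
    Integrable (fun t : ℝ ↦ Real.exp (-(κ * |t|))) := by
  rw [← integrableOn_univ, ← Iic_union_Ioi (a := (0 : ℝ)), integrableOn_union]
  constructor
  · refine (integrableOn_exp_mul_Iic hκ 0).congr_fun (fun t ht ↦ ?_) measurableSet_Iic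
    simp [abs_of_nonpos (show t ≤ 0 from ht)]
  · refine (integrableOn_exp_mul_Ioi (neg_lt_zero.2 hκ) 0).congr_fun (fun t ht ↦ ?_)
      measurableSet_Ioi
    simp [abs_of_pos (show 0 < t from ht)]

lemma differentiableAt_Gamma_of_re_pos {s : ℂ} (hs : 0 < s.re) :
    DifferentiableAt ℂ Complex.Gamma s := by
  refine Complex.differentiableAt_Gamma s fun m hm ↦ ?_
  have : s.re = -m := by simp [hm]
  linarith [m.cast_nonneg (α := ℝ)]

/-- The Gamma product on the line `Re w = c`, as a function of the imaginary part. -/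
lemma continuous_Gamma_mul_Gamma_line {c : ℝ} (hc1 : -1 < c) (hc2 : c < 0) :
    Continuous fun t : ℝ ↦
      Complex.Gamma (1 + ((c : ℂ) + t * I)) * Complex.Gamma (-((c : ℂ) + t * I)) := by
  refine continuous_iff_continuousAt.2 fun t ↦ ContinuousAt.mul ?_ ?_
  · refine ContinuousAt.comp (g := Complex.Gamma) (DifferentiableAt.continuousAt (𝕜 := ℂ) ?_)
      (by fun_prop)
    exact differentiableAt_Gamma_of_re_pos (by simp; linarith)
  · refine ContinuousAt.comp (g := Complex.Gamma) (DifferentiableAt.continuousAt (𝕜 := ℂ) ?_)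
      (by fun_prop)
    exact differentiableAt_Gamma_of_re_pos (by simp; linarith)

lemma integrable_Gamma_mul_Gamma_mul_cexp {c : ℝ} (hc1 : -1 < c) (hc2 : c < 0) {ℓ : ℂ}
    (hℓ : |ℓ.re| < Real.pi) :
    Integrable fun t : ℝ ↦ Complex.Gamma (1 + ((c : ℂ) + t * I)) *
      Complex.Gamma (-((c : ℂ) + t * I)) * cexp (ℓ * t) := by
  have h := (integrable_exp_neg_mul_abs (sub_pos.2 hℓ)).const_mul
    (2 * Real.pi / Real.sin (Real.pi * -c))
  refine h.mono' (((continuous_Gamma_mul_Gamma_line hc1 hc2).mul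
    (by fun_prop)).aestronglyMeasurable) (.of_forall fun t ↦ ?_)
  have h2 := norm_Gamma_mul_Gamma_one_sub_le (-((c : ℂ) + t * I)) (by simp [hc2])
    (by simp; linarith)
  have hsin : 0 < Real.sin (Real.pi * -c) :=
    Real.sin_pos_of_pos_of_lt_pi (by nlinarith [Real.pi_pos]) (by nlinarith [Real.pi_pos])
  have h3 : ‖cexp (ℓ * t)‖ ≤ Real.exp (|ℓ.re| * |t|) := by
    rw [Complex.norm_exp, re_mul_ofReal, ← abs_mul]
    exact Real.exp_le_exp.2 (le_abs_self _)
  rw [norm_mul, mul_comm (Complex.Gamma (1 + _))]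
  rw [sub_neg_eq_add] at h2
  have h4 : (-((c : ℂ) + t * I)).re = -c ∧ |(-((c : ℂ) + t * I)).im| = |t| := by simp
  rw [h4.1, h4.2] at h2
  refine (mul_le_mul h2 h3 (norm_nonneg _) (by positivity)).trans_eq ?_
  rw [mul_assoc, ← Real.exp_add]
  ring_nf

/-- Mellin–Barnes representation of `(1 + exp ℓ)⁻¹` for real `ℓ`. -/
lemma integral_Gamma_mul_Gamma_mul_cexp_ofReal {c : ℝ} (hc1 : -1 < c) (hc2 : c < 0) (ℓ : ℝ) :
    ∫ t : ℝ, Complex.Gamma (1 + ((c : ℂ) + t * I)) * Complex.Gamma (-((c : ℂ) + t * I)) *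
      cexp (((c : ℂ) + t * I) * ℓ) = 2 * Real.pi * (1 + cexp ℓ)⁻¹ := by
  have hmel : ∀ y : ℝ, mellin (fun y : ℝ ↦ (1 + (y : ℂ))⁻¹) ((-c : ℝ) + y * I) =
      Complex.Gamma (1 + ((c : ℂ) + (-y : ℝ) * I)) *
        Complex.Gamma (-((c : ℂ) + (-y : ℝ) * I)) := fun y ↦ by
    rw [mellin_one_add_inv (by simp [hc2]) (by simp; linarith), mul_comm]
    congr 2 <;> (push_cast; ring)
  have hvert : VerticalIntegrable (mellin (fun y : ℝ ↦ (1 + (y : ℂ))⁻¹)) (-c) := by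
    have := (integrable_Gamma_mul_Gamma_mul_cexp hc1 hc2 (ℓ := 0) (by simp [Real.pi_pos])).comp_neg
    refine this.congr (.of_forall fun y ↦ ?_)
    simp only [hmel y, zero_mul, Complex.exp_zero, mul_one]
  have hinv := mellinInv_mellin_eq (-c) (fun y : ℝ ↦ (1 + (y : ℂ))⁻¹) (Real.exp_pos ℓ)
    (mellinConvergent_one_add_inv (by simp [hc2]) (by simp; linarith)) hvert
    (ContinuousAt.inv₀ (by fun_prop) (by norm_cast; positivity))
  rw [mellinInv, ← integral_neg_eq_self] at hinv
  have hcongr : ∀ t : ℝ, ((Real.exp ℓ : ℝ) : ℂ) ^ (-(((-c : ℝ) : ℂ) + ((-t : ℝ) : ℂ) * I)) •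
      mellin (fun y : ℝ ↦ (1 + (y : ℂ))⁻¹) (((-c : ℝ) : ℂ) + ((-t : ℝ) : ℂ) * I) =
      Complex.Gamma (1 + ((c : ℂ) + t * I)) * Complex.Gamma (-((c : ℂ) + t * I)) *
        cexp (((c : ℂ) + t * I) * ℓ) := fun t ↦ by
    rw [hmel, neg_neg, smul_eq_mul, mul_comm]
    congr 1
    rw [cpow_def_of_ne_zero (by norm_cast; positivity), ← ofReal_log (Real.exp_pos ℓ).le,
      Real.log_exp]
    push_cast
    ring_nf
  simp_rw [hcongr] at hinv
  rw [← ofReal_exp, ← hinv, Complex.real_smul]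
  push_cast
  have : 2 * (Real.pi : ℂ) ≠ 0 := by simp [Real.pi_ne_zero]
  rw [← mul_assoc, mul_one_div_cancel this, one_mul]

lemma one_add_cexp_ne_zero {ℓ : ℂ} (hℓ : |ℓ.im| < Real.pi) : 1 + cexp ℓ ≠ 0 := by
  intro h
  have h1 : cexp ℓ = -1 := by linear_combination h
  have h2 : Complex.log (cexp ℓ) = ℓ :=
    Complex.log_exp (abs_lt.1 hℓ).1 (abs_lt.1 hℓ).2.le
  rw [h1, Complex.log_neg_one] at h2
  rw [← h2] at hℓ
  simp [abs_of_pos Real.pi_pos] at hℓ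

/-- Mellin–Barnes representation of `(1 + exp ℓ)⁻¹` in the strip `|Im ℓ| < π`. -/
lemma integral_Gamma_mul_Gamma_mul_cexp {c : ℝ} (hc1 : -1 < c) (hc2 : c < 0) {ℓ : ℂ}
    (hℓ : |ℓ.im| < Real.pi) :
    ∫ t : ℝ, Complex.Gamma (1 + ((c : ℂ) + t * I)) * Complex.Gamma (-((c : ℂ) + t * I)) *
      cexp (((c : ℂ) + t * I) * ℓ) = 2 * Real.pi * (1 + cexp ℓ)⁻¹ := by
  set g : ℝ → ℂ := fun t ↦
    Complex.Gamma (1 + ((c : ℂ) + t * I)) * Complex.Gamma (-((c : ℂ) + t * I)) with hg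
  have hsplit : ∀ ℓ : ℂ, ∫ t : ℝ, g t * cexp (((c : ℂ) + t * I) * ℓ) =
      cexp (c * ℓ) * ∫ t : ℝ, g t * cexp (I * ℓ * t) := fun ℓ ↦ by
    rw [← integral_const_mul]
    refine integral_congr_ae (.of_forall fun t ↦ ?_)
    simp only
    rw [mul_left_comm, ← Complex.exp_add]
    ring_nf
  have hL := differentiableOn_integral_mul_cexp (μ := volume) (φ := g)
    (S := Metric.ball 0 Real.pi) Metric.isOpen_ball (fun r hr ↦
      integrable_Gamma_mul_Gamma_mul_cexp hc1 hc2 (by simpa using hr))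
  have hR : DifferentiableOn ℂ
      (fun z : ℂ ↦ cexp (-(c * (-I * z))) * (2 * Real.pi * (1 + cexp (-I * z))⁻¹))
      {z | z.re ∈ Metric.ball 0 Real.pi} := by
    intro z hz
    refine DifferentiableAt.differentiableWithinAt ?_
    have : 1 + cexp (-I * z) ≠ 0 := one_add_cexp_ne_zero (by simpa using hz)
    fun_prop (disch := exact this)
  have := eqOn_of_eventually_eq_on_line (z₀ := 0) (v := I)
    (Metric.isOpen_ball.preimage continuous_re)
    ((convex_ball (0 : ℝ) Real.pi).linear_preimage reLm) hL hR
    (by simp [Real.pi_pos]) I_ne_zero (.of_forall fun r ↦ ?_) (x := I * ℓ) (by simpa using hℓ)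
  · rw [hsplit]
    simp only at this
    rw [this, ← mul_assoc, ← Complex.exp_add]
    simp [← mul_assoc]
  · have h1 := integral_Gamma_mul_Gamma_mul_cexp_ofReal hc1 hc2 r
    have h2 := hsplit r
    simp only [hg] at h2
    rw [h1] at h2
    have h3 : -I * (0 + r * I) = (r : ℂ) := by linear_combination (-r : ℂ) * I_mul_I
    rw [h3, h2, ← mul_assoc, ← Complex.exp_add, neg_add_cancel, Complex.exp_zero, one_mul, zero_add,
      mul_comm I]

lemma abs_arg_neg_lt_pi {z : ℂ} (hz : ∀ r : ℝ, 0 ≤ r → z ≠ r) : |(-z).arg| < Real.pi := by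
  refine abs_lt.2 ⟨neg_pi_lt_arg _, lt_of_le_of_ne (arg_le_pi _) fun h ↦ ?_⟩
  obtain ⟨h1, h2⟩ := arg_eq_pi_iff.1 h
  refine hz z.re (by simpa using h1.le) (Complex.ext (by simp) ?_)
  simpa using h2

/-- For `Re s > 0`, `Re a > 0`, `max(-Re a, -1) < c < 0` and
`z ∉ [0,∞)`, the Mellin–Barnes integral equals the real-integral representation of the
Lerch transcendent; i.e. the Mellin–Barnes integral analytically continues `Φ(z,s,a)`
to the plane cut along `[0,∞)`. -/
theorem lerch_mellinBarnes_eq_integral (s a : ℂ) (c : ℝ) (z : ℂ)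
    (hs : 0 < s.re) (ha : 0 < a.re)
    (hc1 : max (-a.re) (-1) < c) (hc2 : c < 0)
    (hz : ∀ r : ℝ, 0 ≤ r → z ≠ r) :
    (1 / (2 * (Real.pi : ℂ))) *
      ∫ t : ℝ,
        Complex.Gamma (1 + ((c : ℂ) + t * I)) * Complex.Gamma (-((c : ℂ) + t * I)) *
          (-z) ^ ((c : ℂ) + t * I) / (a + ((c : ℂ) + t * I)) ^ s
    = (1 / Complex.Gamma s) *
        ∫ x in Ioi (0 : ℝ),
          (x : ℂ) ^ (s - 1) * Complex.exp (-a * x) / (1 - z * Complex.exp (-x)) := by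
  obtain ⟨hac, hc1⟩ := max_lt_iff.1 hc1
  have hz0 : -z ≠ 0 := neg_ne_zero.2 (by simpa using hz 0 le_rfl)
  have hΓ : Complex.Gamma s ≠ 0 := Gamma_ne_zero_of_re_pos hs
  have hπ : (Real.pi : ℂ) ≠ 0 := by exact_mod_cast Real.pi_ne_zero
  have harg : |(Complex.log (-z)).im| < Real.pi := by
    rw [log_im]; exact abs_arg_neg_lt_pi hz
  set g : ℝ → ℂ := fun t ↦
    Complex.Gamma (1 + ((c : ℂ) + t * I)) * Complex.Gamma (-((c : ℂ) + t * I)) with hg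
  set h : ℝ → ℂ := fun t ↦ g t * cexp (I * Complex.log (-z) * t) with hh
  set k : ℝ → ℂ := fun x ↦ (x : ℂ) ^ (s - 1) * cexp (-(a + c) * x) with hk
  have hh_int : Integrable h := integrable_Gamma_mul_Gamma_mul_cexp hc1 hc2 (by simpa using harg)
  have hk_int : IntegrableOn k (Ioi 0) :=
    integrableOn_cpow_mul_cexp hs (by simp; linarith)
  have hK_int : Integrable (Function.uncurry fun (t x : ℝ) ↦ h t * k x * cexp (-(t * x * I)))
      (volume.prod (volume.restrict (Ioi (0 : ℝ)))) := by
    refine (hh_int.mul_prod hk_int).mul_bdd (c := 1) ?_ (.of_forall fun p ↦ ?_)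
    · exact Continuous.aestronglyMeasurable (by fun_prop)
    · simp [Complex.norm_exp]
  have hswap := integral_integral_swap hK_int
  have hl : ∀ t : ℝ, ∫ x in Ioi (0 : ℝ), h t * k x * cexp (-(t * x * I)) =
      cexp (-(c * Complex.log (-z))) * Complex.Gamma s *
        (g t * (-z) ^ ((c : ℂ) + t * I) / (a + ((c : ℂ) + t * I)) ^ s) := fun t ↦ by
    have h1 : ∀ x : ℝ, h t * k x * cexp (-(t * x * I)) =
        h t * ((x : ℂ) ^ (s - 1) * cexp (-(a + ((c : ℂ) + t * I)) * x)) := fun x ↦ by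
      have h2 : cexp (-(a + c) * x) * cexp (-(t * x * I)) =
          cexp (-(a + ((c : ℂ) + t * I)) * x) := by
        rw [← Complex.exp_add]
        ring_nf
      simp only [hk]
      linear_combination (h t * (x : ℂ) ^ (s - 1)) * h2
    simp_rw [h1]
    rw [integral_const_mul, integral_cpow_mul_cexp hs (by simp; linarith),
      cpow_def_of_ne_zero hz0]
    have h2 : h t = cexp (-(c * Complex.log (-z))) * g t *
        cexp (Complex.log (-z) * ((c : ℂ) + t * I)) := by
      have h3 : cexp (I * Complex.log (-z) * t) = cexp (-(c * Complex.log (-z))) *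
          cexp (Complex.log (-z) * ((c : ℂ) + t * I)) := by
        rw [← Complex.exp_add]
        ring_nf
      simp only [hh]
      linear_combination g t * h3
    rw [h2]
    ring
  have hr : ∀ x : ℝ, ∫ t : ℝ, h t * k x * cexp (-(t * x * I)) =
      cexp (-(c * Complex.log (-z))) * (2 * Real.pi) *
        ((x : ℂ) ^ (s - 1) * cexp (-a * x) / (1 - z * cexp (-x))) := fun x ↦ by
    have h1 : ∀ t : ℝ, h t * k x * cexp (-(t * x * I)) =
        cexp (-(c * Complex.log (-z))) * ((x : ℂ) ^ (s - 1) * cexp (-a * x)) *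
          (g t * cexp (((c : ℂ) + t * I) * (Complex.log (-z) - x))) := fun t ↦ by
      have h2 : cexp (I * Complex.log (-z) * t) * cexp (-(a + c) * x) * cexp (-(t * x * I)) =
          cexp (-(c * Complex.log (-z))) * cexp (-a * x) *
            cexp (((c : ℂ) + t * I) * (Complex.log (-z) - x)) := by
        simp only [← Complex.exp_add]
        ring_nf
      simp only [hh, hk]
      linear_combination (g t * (x : ℂ) ^ (s - 1)) * h2
    simp_rw [h1]
    rw [integral_const_mul, integral_Gamma_mul_Gamma_mul_cexp hc1 hc2 (by simpa using harg),
      sub_eq_add_neg (Complex.log (-z)), Complex.exp_add, Complex.exp_log hz0]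
    ring_nf
  simp_rw [hl, hr] at hswap
  rw [integral_const_mul, integral_const_mul, mul_assoc, mul_assoc] at hswap
  have hfin := mul_left_cancel₀ (Complex.exp_ne_zero _) hswap
  rw [one_div_mul_eq_div, one_div_mul_eq_div, div_eq_div_iff (by simp [hπ]) hΓ,
    mul_comm _ (Complex.Gamma s), hfin, mul_comm]
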